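/- arXiv:2308.01753 — 3 statements merged into one kernel-verified Lean document; each statement's English description precedes it below -/
import Mathlib

section
/- Let 𝓑 ⊆ ℝ^N be a nonempty compact set satisfying sup_{p,q ∈ 𝓑} ‖p − q‖ ≥ K for some K > 0. Then the halved mean width of 𝓑 satisfies ∫_{S^{N-1}} B(𝓑,u) dσ(u) ≥ K/(3√N). -/
open MeasureTheory Metric Set TopologicalSpace Filter
open scoped RealInnerProductSpace NNReal ENNReal

noncomputable section

abbrev Euc (N : ℕ) := EuclideanSpace ℝ (Fin N)

/-- The outreach (support) function of a set. -/
def outreach {N : ℕ} (B : Set (Euc N)) (u : Euc N) : ℝ :=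
  sSup ((fun b => ⟪b, u⟫) '' B)

/-- The half-space `Π⁻(u,b)`. -/
def halfSpace {N : ℕ} (u : Euc N) (b : ℝ) : Set (Euc N) := {x | ⟪u, x⟫ ≤ b}

/-- The uniform probability measure on the unit sphere. -/
def sphereMeasure (N : ℕ) : Measure (Metric.sphere (0 : Euc N) 1) :=
  (((volume : Measure (Euc N)).toSphere) Set.univ)⁻¹ • ((volume : Measure (Euc N)).toSphere)

/-- The sup-norm of a function restricted to the unit sphere. -/
def supNormSphere {N : ℕ} (f : Euc N → ℝ) : ℝ :=
  ⨆ x : Metric.sphere (0 : Euc N) 1, |f x|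

/-- The dispersion of a set of directions. -/
def dispersion {N : ℕ} (S : Set (Euc N)) : ℝ :=
  ⨆ u : Metric.sphere (0 : Euc N) 1, ⨅ v : S, ‖(u : Euc N) - (v : Euc N)‖

/-- `ε`-accurate quadrature on the unit sphere. -/
def IsAccurateQuadrature {N : ℕ} {ι : Type*} [Fintype ι]
    (u : ι → Euc N) (w : ι → ℝ) (ε : ℝ) : Prop :=
  (∀ i, u i ∈ Metric.sphere (0 : Euc N) 1) ∧ (∀ i, 0 ≤ w i) ∧
  ∀ (L : ℝ≥0) (f : Euc N → ℝ), LipschitzOnWith L f (Metric.sphere (0 : Euc N) 1) →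
    |(∫ x : Metric.sphere (0 : Euc N) 1, f x ∂(sphereMeasure N)) - ∑ i, w i * f (u i)|
      ≤ ε * (L + supNormSphere f)

/-- Halved mean width. -/
def meanHalfWidth {N : ℕ} (B : Set (Euc N)) : ℝ :=
  ∫ u : Metric.sphere (0 : Euc N) 1, outreach B (u : Euc N) ∂(sphereMeasure N)

/-- Feasible solutions of the continuous problem. -/
def CInf {N : ℕ} (C : Euc N → ℝ) : Set (Set (Euc N)) :=
  {B | B.Nonempty ∧ Convex ℝ B ∧ IsCompact B ∧
    ∀ u ∈ Metric.sphere (0 : Euc N) 1, C u ≤ outreach B u}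

/-- Optimal value of the continuous problem. -/
def VCP {N : ℕ} (C : Euc N → ℝ) : ℝ := sInf (meanHalfWidth '' CInf C)

/-- `γ`-near optimal solutions of the continuous problem. -/
def CGamma {N : ℕ} (C : Euc N → ℝ) (γ : ℝ) : Set (Set (Euc N)) :=
  {B ∈ CInf C | meanHalfWidth B - VCP C ≤ γ}

/-- Feasible solutions of the discrete problem with node set `S`. -/
def DInf {N : ℕ} (C : Euc N → ℝ) (S : Set (Euc N)) : Set (Set (Euc N)) :=
  {B | B.Nonempty ∧ Convex ℝ B ∧ IsCompact B ∧ ∀ u ∈ S, C u ≤ outreach B u}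

/-- Discrete objective. -/
def quadSum {N : ℕ} {ι : Type*} [Fintype ι] (u : ι → Euc N) (w : ι → ℝ)
    (B : Set (Euc N)) : ℝ :=
  ∑ i, w i * outreach B (u i)

/-- Optimal value of the discrete problem. -/
def VDP {N : ℕ} {ι : Type*} [Fintype ι] (u : ι → Euc N) (w : ι → ℝ) (C : Euc N → ℝ) : ℝ :=
  sInf (quadSum u w '' DInf C (Set.range u))

/-- `γ`-near optimal solutions of the discrete problem. -/
def DGamma {N : ℕ} {ι : Type*} [Fintype ι] (u : ι → Euc N) (w : ι → ℝ) (C : Euc N → ℝ)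
    (γ : ℝ) : Set (Set (Euc N)) :=
  {B ∈ DInf C (Set.range u) | quadSum u w B - VDP u w C ≤ γ}

open ProbabilityTheory in
lemma gauss_density (N : ℕ) : stdGaussian (Euc N) =
    (volume : Measure (Euc N)).withDensity
      (fun x => ENNReal.ofReal ((2 * Real.pi) ^ (-(N / 2 : ℝ)) * Real.exp (-(1/2) * ‖x‖ ^ 2))) := by
  have hc : 0 < (2 * Real.pi) ^ (-(N / 2 : ℝ)) := by positivity
  have hint : Integrable (fun x : Euc N => Real.exp (-(1/2) * ‖x‖ ^ 2)) := by
    have h := GaussianFourier.integral_rexp_neg_mul_sq_norm (V := Euc N) (b := 1/2) (by norm_num)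
    by_contra hn
    rw [integral_undef hn] at h
    have : 0 < (Real.pi / (1/2)) ^ (Module.finrank ℝ (Euc N) / 2 : ℝ) := by positivity
    linarith
  have : IsFiniteMeasure ((volume : Measure (Euc N)).withDensity
      (fun x => ENNReal.ofReal ((2 * Real.pi) ^ (-(N / 2 : ℝ)) * Real.exp (-(1/2) * ‖x‖ ^ 2)))) :=
    isFiniteMeasure_withDensity_ofReal (hint.const_mul _).2
  apply Measure.ext_of_charFun
  ext t
  rw [charFun_stdGaussian, charFun_apply,
    integral_withDensity_eq_integral_toReal_smul (by fun_prop) (ae_of_all _ fun _ => ENNReal.ofReal_lt_top)]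
  have h := GaussianFourier.integral_cexp_neg_mul_sq_norm_add (V := Euc N) (b := 1/2)
    (by norm_num) Complex.I t
  have h2 : ∀ x : Euc N, (ENNReal.ofReal ((2 * Real.pi) ^ (-(N / 2 : ℝ)) *
      Real.exp (-(1/2) * ‖x‖ ^ 2))).toReal • Complex.exp (⟪x, t⟫ * Complex.I)
      = (((2 * Real.pi) ^ (-(N / 2 : ℝ)) : ℝ) : ℂ) *
        Complex.exp (-(1/2) * ‖x‖ ^ 2 + Complex.I * ⟪t, x⟫) := by
    intro x
    rw [ENNReal.toReal_ofReal (by positivity), Complex.exp_add, real_inner_comm, Complex.real_smul]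
    push_cast
    ring_nf
  simp_rw [h2]
  rw [integral_const_mul, h]
  have h3 : ((Real.pi : ℂ) / (1/2)) ^ ((Module.finrank ℝ (Euc N) : ℂ) / 2)
      = (((2 * Real.pi) ^ (N / 2 : ℝ) : ℝ) : ℂ) := by
    rw [Complex.ofReal_cpow (by positivity)]
    push_cast
    simp
    ring_nf
  rw [h3, ← mul_assoc, ← Complex.ofReal_mul, ← Real.rpow_add (by positivity)]
  simp
  ring_nf

open ProbabilityTheory in
lemma polar_gauss (N : ℕ) : ∃ M : ℝ, ∀ f : Euc N → ℝ,
    (∀ (r : ℝ) (x : Euc N), 0 < r → f (r • x) = r * f x) → N ≠ 0 →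
    ∫ x, f x ∂(stdGaussian (Euc N)) =
      (∫ u : Metric.sphere (0 : Euc N) 1, f u ∂((volume : Measure (Euc N)).toSphere)) * M := by
  refine ⟨∫ r : Ioi (0:ℝ), ((2 * Real.pi) ^ (-(N / 2 : ℝ)) * Real.exp (-(1/2) * (r:ℝ) ^ 2)) * r
    ∂(Measure.volumeIoiPow (Module.finrank ℝ (Euc N) - 1)), fun f hf hN => ?_⟩
  have : NeZero N := ⟨hN⟩
  rw [gauss_density, integral_withDensity_eq_integral_toReal_smul (by fun_prop)
    (ae_of_all _ fun _ => ENNReal.ofReal_lt_top)]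
  set c := (2 * Real.pi) ^ (-(N / 2 : ℝ)) with hcdef
  have hc : 0 < c := by positivity
  rw [← integral_prod_mul]
  have := (volume : Measure (Euc N)).measurePreserving_homeomorphUnitSphereProd.integral_comp
        (Homeomorph.measurableEmbedding _) (fun z : Metric.sphere (0 : Euc N) 1 × Ioi (0:ℝ) =>
          f z.1 * (c * Real.exp (-(1/2) * (z.2:ℝ) ^ 2) * z.2))
  rw [← this]
  rw [← restrict_compl_singleton (μ := (volume : Measure (Euc N))) 0,
    ← integral_subtype_comap (measurableSet_singleton _).compl]
  congr 1
  · rw [restrict_compl_singleton]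
  ext x
  have hx : (0:ℝ) < ‖(x : Euc N)‖ := norm_pos_iff.2 x.2
  rw [ENNReal.toReal_ofReal (by positivity)]
  simp only [homeomorphUnitSphereProd_apply_snd_coe, homeomorphUnitSphereProd_apply_fst_coe]
  rw [hf _ _ (by positivity)]
  simp
  field_simp

lemma sphere_gauss (N : ℕ) (hN : N ≠ 0) (f : Euc N → ℝ)
    (hf : ∀ (r : ℝ) (x : Euc N), 0 < r → f (r • x) = r * f x) :
    (∫ u : Metric.sphere (0 : Euc N) 1, f u ∂(sphereMeasure N)) *
      (∫ x, ‖x‖ ∂(ProbabilityTheory.stdGaussian (Euc N))) =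
    ∫ x, f x ∂(ProbabilityTheory.stdGaussian (Euc N)) := by
  have : NeZero N := ⟨hN⟩
  obtain ⟨M, hM⟩ := polar_gauss N
  rw [hM f hf hN, hM (fun x => ‖x‖) (fun r x hr => by
    rw [norm_smul, Real.norm_of_nonneg hr.le]) hN]
  rw [sphereMeasure, integral_smul_measure]
  have h1 : ∀ u : Metric.sphere (0 : Euc N) 1, ‖(u : Euc N)‖ = 1 := fun u => by simp
  simp_rw [h1]
  have hS : (volume : Measure (Euc N)).toSphere.real univ ≠ 0 := by
    rw [measureReal_ne_zero_iff, Measure.measure_univ_ne_zero]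
    exact Measure.toSphere_ne_zero _
  rw [integral_const, smul_eq_mul, smul_eq_mul, ENNReal.toReal_inv, ← measureReal_def]
  field_simp

open ProbabilityTheory in
lemma gauss_sq (N : ℕ) (L : StrongDual ℝ (Euc N)) :
    ∫ x, L x ^ 2 ∂(stdGaussian (Euc N)) = ‖L‖ ^ 2 := by
  rw [← variance_dual_stdGaussian, variance_of_integral_eq_zero L.continuous.aemeasurable
    (integral_strongDual_stdGaussian L)]

open ProbabilityTheory in
lemma gauss_norm_le (N : ℕ) (hN : N ≠ 0) :
    ∫ x, ‖x‖ ∂(stdGaussian (Euc N)) ≤ Real.sqrt N := by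
  have hi : Integrable (fun x : Euc N => ‖x‖ ^ 2) (stdGaussian (Euc N)) :=
    (IsGaussian.memLp_two_id (μ := stdGaussian (Euc N))).integrable_norm_pow (by norm_num)
  have hsq : ∫ x, ‖x‖ ^ 2 ∂(stdGaussian (Euc N)) = N := by
    simp_rw [EuclideanSpace.real_norm_sq_eq]
    rw [integral_finsetSum]
    · have : ∀ i : Fin N, ∫ x : Euc N, x i ^ 2 ∂(stdGaussian (Euc N)) = 1 := by
        intro i
        have := gauss_sq N (innerSL ℝ (EuclideanSpace.single i (1:ℝ)))
        simpa [EuclideanSpace.inner_single_left] using this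
      simp [this]
    · intro i _
      have := (IsGaussian.memLp_dual (stdGaussian (Euc N))
        (innerSL ℝ (EuclideanSpace.single i (1:ℝ))) 2 (by simp)).integrable_sq
      simpa [EuclideanSpace.inner_single_left] using this
  have hs : 0 < Real.sqrt N := by positivity
  have hss : Real.sqrt N ^ 2 = N := Real.sq_sqrt (by positivity)
  calc ∫ x, ‖x‖ ∂(stdGaussian (Euc N))
      ≤ ∫ x, (‖x‖ ^ 2 / (2 * Real.sqrt N) + Real.sqrt N / 2) ∂(stdGaussian (Euc N)) := by
        apply integral_mono (IsGaussian.integrable_id.norm) ((hi.div_const _).add (integrable_const _))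
        intro x
        have : ‖x‖ ^ 2 / (2 * Real.sqrt N) + Real.sqrt N / 2 - ‖x‖
          = (‖x‖ - Real.sqrt N) ^ 2 / (2 * Real.sqrt N) := by field_simp; ring
        have h2 : 0 ≤ (‖x‖ - Real.sqrt N) ^ 2 / (2 * Real.sqrt N) := by positivity
        change ‖x‖ ≤ ‖x‖ ^ 2 / (2 * Real.sqrt N) + Real.sqrt N / 2
        linarith
    _ = Real.sqrt N := by
        rw [integral_add (hi.div_const _) (integrable_const _), integral_div, hsq]
        simp
        field_simp
        linarith

open ProbabilityTheory in
lemma gauss_abs_real : 2 / 3 ≤ ∫ x, |x| ∂(gaussianReal 0 1) := by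
  rw [integral_gaussianReal_eq_integral_smul (by simp)]
  have h : ∀ x : ℝ, gaussianPDFReal 0 1 x • |x|
      = (fun y : ℝ => (Real.sqrt (2 * Real.pi))⁻¹ * (y * Real.exp (-(1/2) * y ^ 2))) |x| := by
    intro x
    simp [gaussianPDFReal]
    ring_nf
  simp_rw [h]
  rw [integral_comp_abs (f := fun y : ℝ => (Real.sqrt (2 * Real.pi))⁻¹ * (y * Real.exp (-(1/2) * y ^ 2))), integral_const_mul]
  have h2 := integral_rpow_mul_exp_neg_mul_rpow (p := 2) (q := 1) (b := 1/2)
    (by norm_num) (by norm_num) (by norm_num)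
  norm_num at h2
  norm_num
  rw [h2]
  have h4 := Real.pi_lt_d2
  have : Real.sqrt 2 * Real.sqrt Real.pi ≤ 3 := by
    rw [← Real.sqrt_mul (by norm_num)]
    apply Real.sqrt_le_iff.2
    constructor <;> linarith
  have hp : 0 < Real.sqrt 2 * Real.sqrt Real.pi := by positivity
  have h5 : (Real.sqrt Real.pi)⁻¹ * (Real.sqrt 2)⁻¹ = (Real.sqrt 2 * Real.sqrt Real.pi)⁻¹ := by
    rw [mul_inv, mul_comm]
  rw [h5]
  have h6 : (3 : ℝ)⁻¹ ≤ (Real.sqrt 2 * Real.sqrt Real.pi)⁻¹ := inv_anti₀ hp this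
  linarith

open ProbabilityTheory in
lemma gauss_abs (N : ℕ) (v : Euc N) :
    2 / 3 * ‖v‖ ≤ ∫ x, |⟪v, x⟫| ∂(stdGaussian (Euc N)) := by
  rcases eq_or_ne v 0 with rfl | hv
  · simp
  have hv' : 0 < ‖v‖ := norm_pos_iff.2 hv
  set L : StrongDual ℝ (Euc N) := innerSL ℝ (‖v‖⁻¹ • v)
  have hL : ‖L‖ = 1 := by
    simp only [L]
    rw [innerSL_apply_norm, norm_smul]
    simp [hv]
  have hmap : (stdGaussian (Euc N)).map L = gaussianReal 0 1 := by
    rw [IsGaussian.map_eq_gaussianReal, integral_strongDual_stdGaussian,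
      variance_dual_stdGaussian, hL]
    simp
  have h := gauss_abs_real
  rw [← hmap, integral_map (by fun_prop) (by fun_prop)] at h
  have h2 : ∀ x, |⟪v, x⟫| = ‖v‖ * |L x| := by
    intro x
    simp only [L, innerSL_apply_apply, real_inner_smul_left, abs_mul, abs_inv, abs_norm]
    field_simp
  simp_rw [h2]
  rw [integral_const_mul]
  nlinarith

lemma outreach_continuous {N : ℕ} (B : Set (Euc N)) (hBcomp : IsCompact B) :
    Continuous (outreach B) :=
  hBcomp.continuous_sSup (f := fun (u b : Euc N) => ⟪b, u⟫) (by fun_prop)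

lemma outreach_hom {N : ℕ} (B : Set (Euc N)) (r : ℝ) (x : Euc N) (hr : 0 < r) :
    outreach B (r • x) = r * outreach B x := by
  unfold outreach
  rw [← smul_eq_mul, ← Real.sSup_smul_of_nonneg hr.le, ← Set.image_smul, Set.image_image]
  simp_rw [real_inner_smul_right, smul_eq_mul]

lemma le_outreach {N : ℕ} (B : Set (Euc N)) (hBcomp : IsCompact B) (p : Euc N) (hp : p ∈ B)
    (x : Euc N) : ⟪p, x⟫ ≤ outreach B x :=
  le_csSup (hBcomp.image (by fun_prop)).bddAbove ⟨p, hp, rfl⟩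

open ProbabilityTheory in
lemma outreach_integrable {N : ℕ} (B : Set (Euc N)) (hBne : B.Nonempty) (hBcomp : IsCompact B) :
    Integrable (outreach B) (stdGaussian (Euc N)) := by
  obtain ⟨R, hR⟩ := hBcomp.isBounded.exists_norm_le
  obtain ⟨p, hp⟩ := hBne
  refine Integrable.mono' ((IsGaussian.integrable_id (μ := stdGaussian (Euc N))).norm.const_mul R)
    (outreach_continuous B hBcomp).aestronglyMeasurable (ae_of_all _ fun x => ?_)
  have hb : ∀ b ∈ B, |⟪b, x⟫| ≤ R * ‖x‖ := fun b hb =>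
    (abs_real_inner_le_norm b x).trans (by gcongr; exact hR b hb)
  simp only [id]
  rw [Real.norm_eq_abs, abs_le]
  constructor
  · have h1 := le_outreach B hBcomp p hp x
    have := (abs_le.1 (hb p hp)).1
    linarith
  · refine csSup_le (Set.Nonempty.image _ ⟨p, hp⟩) ?_
    rintro _ ⟨b, hb', rfl⟩
    exact (abs_le.1 (hb b hb')).2

lemma exists_diam {N : ℕ} (B : Set (Euc N)) (hBne : B.Nonempty) (hBcomp : IsCompact B) :
    ∃ p ∈ B, ∃ q ∈ B, Metric.diam B ≤ dist p q := by
  have hc : ContinuousOn (fun z : Euc N × Euc N => dist z.1 z.2) (B ×ˢ B) :=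
    (continuous_fst.dist continuous_snd).continuousOn
  obtain ⟨⟨p, q⟩, hz, hmax⟩ := (hBcomp.prod hBcomp).exists_isMaxOn (hBne.prod hBne) hc
  rw [isMaxOn_iff] at hmax
  rw [Set.mem_prod] at hz
  refine ⟨p, hz.1, q, hz.2, Metric.diam_le_of_forall_dist_le dist_nonneg ?_⟩
  intro x hx y hy
  have h := hmax (x, y) (Set.mk_mem_prod hx hy)
  simpa only using h

open ProbabilityTheory in
lemma gauss_outreach {N : ℕ} (B : Set (Euc N)) (hBcomp : IsCompact B)
    (p q : Euc N) (hp : p ∈ B) (hq : q ∈ B) :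
    ‖p - q‖ / 3 ≤ ∫ x, outreach B x ∂(stdGaussian (Euc N)) := by
  have hint := outreach_integrable B ⟨p, hp⟩ hBcomp
  have hlow : ∀ x : Euc N,
      innerSL ℝ ((1/2 : ℝ) • (p + q)) x + 1/2 * |⟪p - q, x⟫| ≤ outreach B x := by
    intro x
    have h1 := le_outreach B hBcomp p hp x
    have h2 := le_outreach B hBcomp q hq x
    rw [innerSL_apply_apply, real_inner_smul_left, inner_add_left, inner_sub_left]
    rcases abs_cases (⟪p, x⟫ - ⟪q, x⟫) with h | h <;> linarith
  have hiL := IsGaussian.integrable_dual (stdGaussian (Euc N)) (innerSL ℝ ((1/2 : ℝ) • (p + q)))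
  have hiA : Integrable (fun x => 1/2 * |⟪p - q, x⟫|) (stdGaussian (Euc N)) :=
    (IsGaussian.integrable_dual (stdGaussian (Euc N)) (innerSL ℝ (p - q))).abs.const_mul _
  have hmono := integral_mono (hiL.add hiA) hint hlow
  simp only [Pi.add_apply] at hmono
  rw [integral_add hiL hiA, integral_strongDual_stdGaussian, integral_const_mul] at hmono
  have hA := gauss_abs N (p - q)
  linarith

/-- a nonempty compact set `𝓑 ⊆ ℝ^N` with `sup_{p,q ∈ 𝓑} ‖p − q‖ ≥ K > 0`
has halved mean width at least `K/(3√N)`. -/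
theorem meanHalfWidth_ge_of_diam {N : ℕ} (B : Set (Euc N))
    (hBne : B.Nonempty) (hBcomp : IsCompact B)
    (K : ℝ) (hK : 0 < K) (hdiam : K ≤ Metric.diam B) :
    K / (3 * Real.sqrt N) ≤ meanHalfWidth B := by
  have hN : N ≠ 0 := by
    rintro rfl
    have := Metric.diam_subsingleton (Set.subsingleton_of_subsingleton (s := B))
    linarith
  obtain ⟨p, hp, q, hq, hpq⟩ := exists_diam B hBne hBcomp
  have hmono := gauss_outreach B hBcomp p q hp hq
  have hsph := sphere_gauss N hN (outreach B) (outreach_hom B)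
  rw [dist_eq_norm] at hpq
  have hE := gauss_norm_le N hN
  have hE0 : 0 ≤ ∫ x, ‖x‖ ∂(ProbabilityTheory.stdGaussian (Euc N)) :=
    integral_nonneg fun _ => norm_nonneg _
  rw [← hsph] at hmono
  unfold meanHalfWidth
  generalize (∫ x, ‖x‖ ∂(ProbabilityTheory.stdGaussian (Euc N))) = E at *
  generalize (∫ u : Metric.sphere (0 : Euc N) 1, outreach B (u : Euc N) ∂(sphereMeasure N)) = W at *
  have hs : 0 < Real.sqrt N := by positivity
  have hmain : K / 3 ≤ W * E := by linarith
  have hpos : 0 ≤ W := by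
    by_contra hneg
    push Not at hneg
    nlinarith
  rw [div_le_iff₀ (by positivity)]
  nlinarith [mul_le_mul_of_nonneg_left hE hpos]
end
end

section
/- Let N ≥ 2, let {(u_i,w_i)}_{i=1}^m ⊆ S^{N-1} × [0,∞) be an ε-accurate quadrature, let 𝒮 = {u_i}_{i=1}^m have dispersion δ = disp(𝒮), and assume ε, δ ≤ 1/(10√N). Then V^CP − V^DP ≤ 12√N ‖C‖_∞ (2ε + δ) + L_C δ, and V^DP − V^CP ≤ 8√N ‖C‖_∞ ε. -/
open MeasureTheory Metric Set TopologicalSpace Filter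
open scoped RealInnerProductSpace NNReal ENNReal

noncomputable section

/-- Polar coordinates for a product function. -/
lemma polar_aux {N : ℕ} (hN : 2 ≤ N) (G : Euc N → ℝ) (g : sphere (0 : Euc N) 1 → ℝ) (F : ℝ → ℝ)
    (h : ∀ (s : sphere (0 : Euc N) 1) (r : ℝ), 0 < r → G (r • (s : Euc N)) = g s * F r) :
    ∫ x, G x = (∫ s, g s ∂((volume : Measure (Euc N)).toSphere)) *
      ∫ r : Ioi (0 : ℝ), F r ∂(Measure.volumeIoiPow (Module.finrank ℝ (Euc N) - 1)) := by
  have : Nonempty (Fin N) := ⟨⟨0, by omega⟩⟩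
  rw [← integral_prod_mul]
  have e1 : ∫ x, G x = ∫ x : ({(0)}ᶜ : Set (Euc N)), G x.1 ∂((volume : Measure (Euc N)).comap Subtype.val) := by
    rw [integral_subtype_comap (measurableSet_singleton _).compl fun x ↦ G x,
        restrict_compl_singleton]
  rw [e1, ← (volume : Measure (Euc N)).measurePreserving_homeomorphUnitSphereProd.integral_comp
        (Homeomorph.measurableEmbedding _)]
  congr 1
  ext x
  have := h ((homeomorphUnitSphereProd (Euc N) x).1) ((homeomorphUnitSphereProd (Euc N) x).2)
    (homeomorphUnitSphereProd (Euc N) x).2.2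
  rw [← this]
  congr 1
  have h2 : (x : Euc N) ≠ 0 := x.2
  simp [smul_smul, h2]

def qq : ℝ := √(2 * Real.pi)

lemma qq_pos : 0 < qq := by unfold qq; positivity

lemma gauss_q : ∫ t : ℝ, Real.exp (-t ^ 2 / 2) = qq := by
  have := integral_gaussian (1/2)
  rw [qq, ← show Real.pi / (1/2) = 2 * Real.pi by ring, ← this]
  congr 1; ext t; congr 1; ring

lemma gauss_abs_s8 : ∫ t : ℝ, |t| * Real.exp (-t ^ 2 / 2) = 2 := by
  have h := integral_comp_abs (f := fun t : ℝ => t * Real.exp (-t ^ 2 / 2))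
  simp only [sq_abs] at h
  rw [h]
  have := integral_rpow_mul_exp_neg_mul_rpow (p := 2) (q := 1) (b := 1/2) (by norm_num)
    (by norm_num) (by norm_num)
  have e : ∫ x in Ioi (0 : ℝ), x * Real.exp (-x ^ 2 / 2) =
      ∫ x in Ioi (0 : ℝ), x ^ (1 : ℝ) * Real.exp (-(1/2) * x ^ (2 : ℝ)) := by
    congr 1; ext t
    rw [Real.rpow_one, show (2 : ℝ) = ((2 : ℕ) : ℝ) by norm_num, Real.rpow_natCast]
    congr 2; push_cast; ring
  rw [e, this]
  norm_num [Real.rpow_neg]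

lemma gauss_sq_s8 : ∫ t : ℝ, t ^ 2 * Real.exp (-t ^ 2 / 2) = qq := by
  have h := integral_comp_abs (f := fun t : ℝ => t ^ 2 * Real.exp (-t ^ 2 / 2))
  simp only [sq_abs] at h
  rw [h]
  have := integral_rpow_mul_exp_neg_mul_rpow (p := 2) (q := 2) (b := 1/2) (by norm_num)
    (by norm_num) (by norm_num)
  have e : ∫ x in Ioi (0 : ℝ), x ^ 2 * Real.exp (-x ^ 2 / 2) =
      ∫ x in Ioi (0 : ℝ), x ^ (2 : ℝ) * Real.exp (-(1/2) * x ^ (2 : ℝ)) := by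
    congr 1; ext t
    rw [show (2 : ℝ) = ((2 : ℕ) : ℝ) by norm_num, Real.rpow_natCast]
    congr 2; push_cast; ring
  rw [e, this]
  have g : Real.Gamma ((2 + 1) / 2) = √Real.pi / 2 := by
    rw [show ((2 : ℝ) + 1) / 2 = 1 / 2 + 1 by norm_num, Real.Gamma_add_one (by norm_num),
      Real.Gamma_one_half_eq]; ring
  have g2 : ((1 / 2 : ℝ)) ^ (-(2 + 1) / 2 : ℝ) = 2 * √2 := by
    rw [show (-(2 + 1) / 2 : ℝ) = -(1 + 1 / 2) by norm_num, one_div, Real.inv_rpow (by norm_num),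
      Real.rpow_neg (by norm_num), inv_inv, Real.rpow_add (by norm_num), Real.rpow_one,
      Real.sqrt_eq_rpow, one_div]
  rw [g, g2, qq, Real.sqrt_mul (by norm_num)]
  ring

/-- Gaussian integral of a function of one coordinate. -/
lemma gauss_coord {N : ℕ} (i : Fin N) (f : ℝ → ℝ) :
    ∫ x : Euc N, f (x i) * Real.exp (-‖x‖ ^ 2 / 2)
      = (∫ t, f t * Real.exp (-t ^ 2 / 2)) * qq ^ (N - 1) := by
  rw [← (EuclideanSpace.volume_preserving_symm_measurableEquiv_toLp (Fin N)).symm.integral_comp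
    (MeasurableEquiv.measurableEmbedding _)]
  have key := integral_fintype_prod_volume_eq_prod (ι := Fin N) (E := fun _ => ℝ) (𝕜 := ℝ)
    (fun j t => (if j = i then f t else 1) * Real.exp (-t ^ 2 / 2))
  have e1 : ∏ j : Fin N, ∫ t : ℝ, (if j = i then f t else 1) * Real.exp (-t ^ 2 / 2)
      = (∫ t, f t * Real.exp (-t ^ 2 / 2)) * qq ^ (N - 1) := by
    rw [← Finset.mul_prod_erase _ _ (Finset.mem_univ i)]
    rw [Finset.prod_congr rfl (g := fun _ => qq)]
    · simp
    · intro j hj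
      simp [Finset.ne_of_mem_erase hj, gauss_q]
  rw [← e1, ← key]
  congr 1; ext x
  rw [Finset.prod_mul_distrib, ← Real.exp_sum]
  congr 1
  · simp
  · congr 1
    rw [EuclideanSpace.norm_sq_eq]
    simp [Finset.sum_div, neg_div]

lemma gauss_total {N : ℕ} (hN : 2 ≤ N) :
    ∫ x : Euc N, Real.exp (-‖x‖ ^ 2 / 2) = qq ^ N := by
  have := gauss_coord (⟨0, by omega⟩ : Fin N) (fun _ => 1)
  simp only [one_mul, gauss_q] at this
  rw [this, ← pow_succ', Nat.sub_add_cancel (by omega)]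

lemma gauss_inner {N : ℕ} (hN : 2 ≤ N) (b : Euc N) :
    ∫ x : Euc N, |⟪b, x⟫| * Real.exp (-‖x‖ ^ 2 / 2) = ‖b‖ * 2 * qq ^ (N - 1) := by
  by_cases hb : b = 0
  · simp [hb]
  have hb' : ‖b‖ ≠ 0 := by simpa using hb
  let i : Fin N := ⟨0, by omega⟩
  obtain ⟨B, hB⟩ := Orthonormal.exists_orthonormalBasis_extension_of_card_eq (𝕜 := ℝ) (E := Euc N)
    (ι := Fin N) (by simp) (v := fun _ => (‖b‖⁻¹ • b : Euc N)) (s := {i}) (by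
      rw [orthonormal_iff_ite]
      rintro ⟨j, rfl⟩ ⟨k, rfl⟩
      have : ‖(‖b‖⁻¹ • b : Euc N)‖ = 1 := by
        rw [norm_smul, norm_inv, norm_norm, inv_mul_cancel₀ hb']
      simp [this])
  have hBi := hB i rfl
  have hrepr : ∀ x, ⟪b, x⟫ = ‖b‖ * (B.repr x) i := by
    intro x
    rw [B.repr_apply_apply, hBi, inner_smul_left]
    simp
    field_simp
  have := B.measurePreserving_repr.integral_comp (B.repr.toHomeomorph.measurableEmbedding)
    (fun x : Euc N => |x i| * Real.exp (-‖x‖ ^ 2 / 2))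
  rw [gauss_coord i (fun t => |t|), gauss_abs_s8] at this
  rw [mul_assoc, ← this, ← integral_const_mul]
  congr 1; ext x
  rw [hrepr, abs_mul, abs_norm, LinearIsometryEquiv.norm_map]
  ring

lemma gauss_norm {N : ℕ} (hN : 2 ≤ N) :
    ∫ x : Euc N, ‖x‖ * Real.exp (-‖x‖ ^ 2 / 2) ≤ √N * qq ^ N := by
  have hNp : (0 : ℝ) < √N := Real.sqrt_pos.2 (by exact_mod_cast (by omega : 0 < N))
  have hq := pow_pos qq_pos N
  have hi1 : Integrable (fun x : Euc N => Real.exp (-‖x‖ ^ 2 / 2)) :=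
    Integrable.of_integral_ne_zero (by rw [gauss_total hN]; exact hq.ne')
  have hc : ∀ i : Fin N, ∫ x : Euc N, (x i) ^ 2 * Real.exp (-‖x‖ ^ 2 / 2) = qq ^ N := by
    intro i
    rw [gauss_coord i (fun t => t ^ 2), gauss_sq_s8, ← pow_succ', Nat.sub_add_cancel (by omega)]
  have hi2 : ∀ i : Fin N, Integrable (fun x : Euc N => (x i) ^ 2 * Real.exp (-‖x‖ ^ 2 / 2)) :=
    fun i => Integrable.of_integral_ne_zero (by rw [hc i]; exact hq.ne')
  have hsum : ∀ x : Euc N, ‖x‖ ^ 2 * Real.exp (-‖x‖ ^ 2 / 2)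
      = ∑ i, (x i) ^ 2 * Real.exp (-‖x‖ ^ 2 / 2) := by
    intro x
    rw [← Finset.sum_mul, EuclideanSpace.norm_sq_eq]
    simp
  have hi3 : Integrable (fun x : Euc N => ‖x‖ ^ 2 * Real.exp (-‖x‖ ^ 2 / 2)) := by
    simp_rw [hsum]
    exact integrable_finsetSum _ (fun i _ => hi2 i)
  have hs : ∫ x : Euc N, ‖x‖ ^ 2 * Real.exp (-‖x‖ ^ 2 / 2) = N * qq ^ N := by
    simp_rw [hsum]
    rw [integral_finsetSum _ (fun i _ => hi2 i)]
    simp [hc]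
  calc ∫ x : Euc N, ‖x‖ * Real.exp (-‖x‖ ^ 2 / 2)
      ≤ ∫ x : Euc N, ((2 * √N)⁻¹ * (‖x‖ ^ 2 * Real.exp (-‖x‖ ^ 2 / 2))
          + (√N / 2) * Real.exp (-‖x‖ ^ 2 / 2)) := by
        refine integral_mono_of_nonneg (Eventually.of_forall fun x => by positivity)
          ((hi3.const_mul _).add (hi1.const_mul _)) (Eventually.of_forall fun x => ?_)
        have : ‖x‖ ≤ (2 * √N)⁻¹ * ‖x‖ ^ 2 + √N / 2 := by
          rw [← sub_nonneg]
          have : (2 * √N)⁻¹ * ‖x‖ ^ 2 + √N / 2 - ‖x‖ = (2 * √N)⁻¹ * (‖x‖ - √N) ^ 2 := by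
            field_simp; ring
          rw [this]; positivity
        have h2 := mul_le_mul_of_nonneg_right this (Real.exp_pos (-‖x‖ ^ 2 / 2)).le
        simp only
        linarith
    _ = √N * qq ^ N := by
        rw [integral_add (hi3.const_mul _) (hi1.const_mul _), integral_const_mul,
          integral_const_mul, hs, gauss_total hN]
        have : (N : ℝ) = √N * √N := (Real.mul_self_sqrt (by positivity)).symm
        field_simp
        nlinarith

lemma sphere_abs_inner {N : ℕ} (hN : 2 ≤ N) (b : Euc N) :
    3 / 4 * ‖b‖ * ((volume : Measure (Euc N)).toSphere.real univ) ≤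
      √N * ∫ s : sphere (0 : Euc N) 1, |⟪b, (s : Euc N)⟫| ∂((volume : Measure (Euc N)).toSphere) := by
  by_cases hb : b = 0
  · simp [hb]
  have h1 := gauss_inner hN b
  rw [polar_aux hN _ (fun s => |⟪b, (s : Euc N)⟫|) (fun r => r * Real.exp (-r ^ 2 / 2)) (by
    intro s r hr
    rw [inner_smul_right, norm_smul, abs_mul, abs_of_pos hr]
    simp [abs_of_pos hr]; ring)] at h1
  have h2 := gauss_norm hN
  rw [polar_aux hN _ (fun s => 1) (fun r => r * Real.exp (-r ^ 2 / 2)) (by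
    intro s r hr
    rw [norm_smul]
    simp [abs_of_pos hr])] at h2
  simp only [integral_const, smul_eq_mul, mul_one] at h2
  set J := ∫ r : Ioi (0 : ℝ), (r : ℝ) * Real.exp (-(r : ℝ) ^ 2 / 2)
    ∂(Measure.volumeIoiPow (Module.finrank ℝ (Euc N) - 1)) with hJ
  have hb' : 0 < ‖b‖ := norm_pos_iff.2 hb
  have hJ0 : 0 ≤ J := integral_nonneg fun r => mul_nonneg r.2.le (Real.exp_pos _).le
  have hJp : 0 < J := by
    refine lt_of_le_of_ne hJ0 fun h => ?_
    rw [← h, mul_zero] at h1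
    have := qq_pos
    have : 0 < ‖b‖ * 2 * qq ^ (N - 1) := by positivity
    linarith
  have hqN : qq ^ N = qq * qq ^ (N - 1) := by
    rw [← pow_succ', Nat.sub_add_cancel (by omega)]
  have hq : 3 / 4 * qq ≤ 2 := by
    have : qq ≤ 8 / 3 := by
      unfold qq
      rw [Real.sqrt_le_left (by norm_num)]
      have := Real.pi_lt_d2
      linarith
    linarith
  refine le_of_mul_le_mul_right ?_ hJp
  calc _ = 3 / 4 * ‖b‖ * ((volume : Measure (Euc N)).toSphere.real univ * J) := by ring
    _ ≤ 3 / 4 * ‖b‖ * (√N * qq ^ N) := by gcongr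
    _ = (‖b‖ * √N * qq ^ (N - 1)) * (3 / 4 * qq) := by rw [hqN]; ring
    _ ≤ (‖b‖ * √N * qq ^ (N - 1)) * 2 := by
      have := qq_pos
      gcongr
    _ = √N * (‖b‖ * 2 * qq ^ (N - 1)) := by ring
    _ = _ := by rw [← h1]; ring

lemma sphere_symm {N : ℕ} (hN : 2 ≤ N) (b : Euc N) (h : ℝ → ℝ) :
    ∫ s : sphere (0 : Euc N) 1, h (-⟪b, (s : Euc N)⟫) ∂((volume : Measure (Euc N)).toSphere)
      = ∫ s : sphere (0 : Euc N) 1, h (⟪b, (s : Euc N)⟫) ∂((volume : Measure (Euc N)).toSphere) := by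
  have h0 := gauss_total hN
  rw [polar_aux hN _ (fun s => 1) (fun r => Real.exp (-r ^ 2 / 2)) (by
    intro s r hr
    rw [norm_smul]
    simp [abs_of_pos hr])] at h0
  have hJ : (∫ r : Ioi (0 : ℝ), Real.exp (-(r : ℝ) ^ 2 / 2)
    ∂(Measure.volumeIoiPow (Module.finrank ℝ (Euc N) - 1))) ≠ 0 := by
    intro h
    rw [h, mul_zero] at h0
    exact (pow_pos qq_pos N).ne h0
  refine mul_right_cancel₀ hJ ?_
  rw [← polar_aux hN (fun x => h (-⟪b, ‖x‖⁻¹ • x⟫) * Real.exp (-‖x‖ ^ 2 / 2))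
      (fun s => h (-⟪b, (s : Euc N)⟫)) (fun r => Real.exp (-r ^ 2 / 2)),
    ← polar_aux hN (fun x => h (⟪b, ‖x‖⁻¹ • x⟫) * Real.exp (-‖x‖ ^ 2 / 2))
      (fun s => h (⟪b, (s : Euc N)⟫)) (fun r => Real.exp (-r ^ 2 / 2)),
    ← integral_neg_eq_self]
  · simp
  · intro s r hr
    rw [norm_smul]
    simp [abs_of_pos hr, smul_smul, hr.ne']
  · intro s r hr
    rw [norm_smul]
    simp [abs_of_pos hr, smul_smul, hr.ne']

lemma sphereMeasure_prob {N : ℕ} (hN : 2 ≤ N) : IsProbabilityMeasure (sphereMeasure N) := by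
  have : Nonempty (Fin N) := ⟨⟨0, by omega⟩⟩
  have : NeZero ((volume : Measure (Euc N)).toSphere) := ⟨Measure.toSphere_ne_zero _⟩
  unfold sphereMeasure
  infer_instance

lemma integral_sphereMeasure {N : ℕ} (f : sphere (0 : Euc N) 1 → ℝ) :
    ∫ s, f s ∂(sphereMeasure N) = ((volume : Measure (Euc N)).toSphere.real univ)⁻¹ *
      ∫ s, f s ∂((volume : Measure (Euc N)).toSphere) := by
  rw [sphereMeasure, integral_smul_measure]
  simp [Measure.real]

lemma key_lower {N : ℕ} (hN : 2 ≤ N) (b : Euc N) (K : ℝ) :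
    3 / 4 * ‖b‖ / √N - K ≤
      2 * ∫ s : sphere (0 : Euc N) 1, max ⟪b, (s : Euc N)⟫ (-K) ∂(sphereMeasure N) := by
  have := sphereMeasure_prob hN
  have : Nonempty (Fin N) := ⟨⟨0, by omega⟩⟩
  have hNp : (0 : ℝ) < √N := Real.sqrt_pos.2 (by exact_mod_cast (by omega : 0 < N))
  have hint : ∀ f : sphere (0 : Euc N) 1 → ℝ, Continuous f → Integrable f (sphereMeasure N) :=
    fun f hf => hf.integrable_of_hasCompactSupport (HasCompactSupport.of_compactSpace f)
  have hA : 0 < (volume : Measure (Euc N)).toSphere.real univ := by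
    rw [Measure.real, ENNReal.toReal_pos_iff]
    exact ⟨by
      rw [pos_iff_ne_zero]
      exact fun h => Measure.toSphere_ne_zero (volume : Measure (Euc N)) (Measure.measure_univ_eq_zero.1 h),
      measure_lt_top _ _⟩
  have h1 : 3 / 4 * ‖b‖ / √N ≤ ∫ s : sphere (0 : Euc N) 1, |⟪b, (s : Euc N)⟫| ∂(sphereMeasure N) := by
    rw [integral_sphereMeasure, div_le_iff₀ hNp, mul_comm, mul_comm _ √(N : ℝ), ← mul_assoc,
      mul_comm √(N : ℝ), mul_assoc, le_inv_mul_iff₀ hA]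
    have := sphere_abs_inner hN b
    linarith
  have h2 : ∫ s : sphere (0 : Euc N) 1, max (-⟪b, (s : Euc N)⟫) (-K) ∂(sphereMeasure N)
      = ∫ s : sphere (0 : Euc N) 1, max (⟪b, (s : Euc N)⟫) (-K) ∂(sphereMeasure N) := by
    rw [integral_sphereMeasure, integral_sphereMeasure, sphere_symm hN b (fun t => max t (-K))]
  rw [two_mul]
  nth_rw 1 [← h2]
  rw [← integral_add (hint _ (by fun_prop)) (hint _ (by fun_prop))]
  have h3 : ∫ s : sphere (0 : Euc N) 1, (|⟪b, (s : Euc N)⟫| - K) ∂(sphereMeasure N)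
     ≤ ∫ s : sphere (0 : Euc N) 1, (max (-⟪b, (s : Euc N)⟫) (-K) + max (⟪b, (s : Euc N)⟫) (-K))
      ∂(sphereMeasure N) := by
    refine integral_mono (hint _ (by fun_prop)) (hint _ (by fun_prop)) fun s => ?_
    simp only
    rcases abs_cases ⟪b, (s : Euc N)⟫ with ⟨h, _⟩ | ⟨h, _⟩ <;> rw [h]
    · linarith [le_max_right (-⟪b, (s : Euc N)⟫) (-K), le_max_left (⟪b, (s : Euc N)⟫) (-K)]
    · linarith [le_max_left (-⟪b, (s : Euc N)⟫) (-K), le_max_right (⟪b, (s : Euc N)⟫) (-K)]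
  rw [integral_sub (hint _ (by fun_prop)) (integrable_const _)] at h3
  simp at h3
  linarith

section OutreachFacts
variable {N : ℕ} {B : Set (Euc N)}

lemma outreach_bdd (hc : IsCompact B) (u : Euc N) : BddAbove ((fun b => ⟪b, u⟫) '' B) :=
  (hc.image (by fun_prop)).bddAbove

lemma le_outreach_s8 (hc : IsCompact B) (u : Euc N) {b : Euc N} (hb : b ∈ B) :
    ⟪b, u⟫ ≤ outreach B u :=
  le_csSup (outreach_bdd hc u) (mem_image_of_mem _ hb)

lemma outreach_le (hn : B.Nonempty) (u : Euc N) {c : ℝ} (h : ∀ b ∈ B, ⟪b, u⟫ ≤ c) :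
    outreach B u ≤ c := by
  refine csSup_le (hn.image _) ?_
  rintro _ ⟨b, hb, rfl⟩
  exact h b hb

lemma outreach_sub_le (hn : B.Nonempty) (hc : IsCompact B) {R : ℝ} (hR : ∀ b ∈ B, ‖b‖ ≤ R)
    (u v : Euc N) : outreach B u ≤ outreach B v + R * ‖u - v‖ := by
  refine outreach_le hn u fun b hb => ?_
  have h1 := le_outreach_s8 hc v hb
  have h2 : ⟪b, u⟫ = ⟪b, v⟫ + ⟪b, u - v⟫ := by rw [inner_sub_right]; ring
  have h3 := real_inner_le_norm b (u - v)
  have h4 := mul_le_mul_of_nonneg_right (hR b hb) (norm_nonneg (u - v))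
  linarith

lemma outreach_lipschitz (hn : B.Nonempty) (hc : IsCompact B) {R : ℝ≥0} (hR : ∀ b ∈ B, ‖b‖ ≤ R) :
    LipschitzWith R (outreach B) := by
  refine LipschitzWith.of_le_add_mul R fun u v => ?_
  rw [dist_eq_norm]
  exact outreach_sub_le hn hc hR u v

lemma outreach_abs_le (hn : B.Nonempty) (hc : IsCompact B) {R : ℝ} (hR : ∀ b ∈ B, ‖b‖ ≤ R)
    {u : Euc N} (hu : ‖u‖ = 1) : |outreach B u| ≤ R := by
  have h0 : outreach B 0 = 0 := by
    apply le_antisymm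
    · exact outreach_le hn 0 (by simp)
    · obtain ⟨b, hb⟩ := hn
      simpa using le_outreach_s8 hc 0 hb
  have h1 := outreach_sub_le hn hc hR u 0
  have h2 : -R ≤ outreach B u := by
    obtain ⟨b, hb⟩ := hn
    have := le_outreach_s8 hc u hb
    have h3 := neg_le_of_abs_le (abs_real_inner_le_norm b u)
    have := hR b hb
    rw [hu] at h3
    linarith
  rw [h0, sub_zero, hu] at h1
  exact abs_le.2 ⟨h2, by linarith⟩

lemma outreach_add_ball (hn : B.Nonempty) (hc : IsCompact B) {r : ℝ} (hr : 0 ≤ r)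
    {u : Euc N} (hu : ‖u‖ = 1) :
    outreach (image2 (· + ·) B (closedBall 0 r)) u = outreach B u + r := by
  have hc' : IsCompact (image2 (· + ·) B (closedBall (0 : Euc N) r)) :=
    hc.add (isCompact_closedBall _ _)
  have hn' : (image2 (· + ·) B (closedBall (0 : Euc N) r)).Nonempty :=
    hn.image2 ⟨0, by simpa using hr⟩
  apply le_antisymm
  · refine outreach_le hn' u ?_
    rintro _ ⟨b, hb, c, hcc, rfl⟩
    simp only [inner_add_left]
    have h1 := le_outreach_s8 hc u hb
    have h2 := real_inner_le_norm c u
    rw [mem_closedBall_zero_iff] at hcc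
    rw [hu] at h2
    linarith
  · rw [← le_sub_iff_add_le]
    refine outreach_le hn u fun b hb => ?_
    have := le_outreach_s8 hc' u (mem_image2_of_mem hb
      (show r • u ∈ closedBall (0 : Euc N) r by simp [norm_smul, hu, abs_of_nonneg hr]))
    simp only [inner_add_left, inner_smul_left, real_inner_self_eq_norm_sq, hu] at this
    simp only [one_pow, mul_one, conj_trivial] at this
    linarith

lemma outreach_ball {r : ℝ} (hr : 0 ≤ r) {u : Euc N} (hu : ‖u‖ = 1) :
    outreach (closedBall (0 : Euc N) r) u = r := by
  have := outreach_add_ball (singleton_nonempty (0 : Euc N)) isCompact_singleton hr hu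
  simpa [outreach] using this

end OutreachFacts

section SupNorm
variable {N : ℕ}

lemma supNorm_le {f : Euc N → ℝ} {M : ℝ} (hM : 0 ≤ M)
    (h : ∀ x ∈ sphere (0 : Euc N) 1, |f x| ≤ M) : supNormSphere f ≤ M :=
  Real.iSup_le (fun x => h x x.2) hM

lemma le_supNorm {f : Euc N → ℝ} (hf : ContinuousOn f (sphere (0 : Euc N) 1)) {x : Euc N}
    (hx : x ∈ sphere (0 : Euc N) 1) : |f x| ≤ supNormSphere f := by
  have hb : BddAbove (range fun x : sphere (0 : Euc N) 1 => |f x|) := by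
    have := ((isCompact_sphere (0 : Euc N) 1).image_of_continuousOn hf.abs).bddAbove
    refine this.mono ?_
    rintro _ ⟨y, rfl⟩
    exact ⟨y, y.2, rfl⟩
  exact le_ciSup hb (⟨x, hx⟩ : sphere (0 : Euc N) 1)

lemma supNorm_nonneg (f : Euc N → ℝ) : 0 ≤ supNormSphere f :=
  Real.iSup_nonneg fun _ => abs_nonneg _

end SupNorm

section Quad
variable {N m : ℕ} {u : Fin m → Euc N} {w : Fin m → ℝ} {ε : ℝ}

lemma quad_bound (hε : 0 ≤ ε) (hq : IsAccurateQuadrature u w ε) {f : Euc N → ℝ} {L : ℝ≥0} {M : ℝ}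
    (hM : 0 ≤ M) (hf : LipschitzWith L f) (h : ∀ x ∈ sphere (0 : Euc N) 1, |f x| ≤ M) :
    |(∫ x : sphere (0 : Euc N) 1, f x ∂(sphereMeasure N)) - ∑ i, w i * f (u i)| ≤ ε * (L + M) :=
  (hq.2.2 L f hf.lipschitzOnWith).trans (by gcongr; exact supNorm_le hM h)

lemma eps_nonneg (hq : IsAccurateQuadrature u w ε) : 0 ≤ ε := by
  have := hq.2.2 1 (fun _ => 0) (LipschitzWith.const' 0).lipschitzOnWith
  have h0 : supNormSphere (fun _ : Euc N => (0 : ℝ)) = 0 :=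
    le_antisymm (supNorm_le le_rfl (by simp)) (supNorm_nonneg _)
  rw [h0] at this
  simpa using this

lemma sum_w (hN : 2 ≤ N) (hq : IsAccurateQuadrature u w ε) : |1 - ∑ i, w i| ≤ ε := by
  have := sphereMeasure_prob hN
  have := quad_bound (eps_nonneg hq) hq (f := fun _ => 1) (L := 0) (M := 1) (by norm_num)
    (LipschitzWith.const 1) (by simp)
  simpa using this

lemma exists_max_norm {B : Set (Euc N)} (hn : B.Nonempty) (hc : IsCompact B) :
    ∃ b ∈ B, ∀ b' ∈ B, ‖b'‖ ≤ ‖b‖ := by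
  obtain ⟨b, hb, h⟩ := hc.exists_isMaxOn hn continuous_norm.continuousOn
  exact ⟨b, hb, fun b' hb' => h hb'⟩

lemma sphere_integrable (hN : 2 ≤ N) (f : sphere (0 : Euc N) 1 → ℝ) (hf : Continuous f) :
    Integrable f (sphereMeasure N) := by
  have := sphereMeasure_prob hN
  exact hf.integrable_of_hasCompactSupport (HasCompactSupport.of_compactSpace f)

/-- Comparison of the two objectives. -/
lemma quad_outreach (hq : IsAccurateQuadrature u w ε) {B : Set (Euc N)}
    (hn : B.Nonempty) (hc : IsCompact B) {R : ℝ} (hR0 : 0 ≤ R) (hR : ∀ b ∈ B, ‖b‖ ≤ R) :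
    |meanHalfWidth B - quadSum u w B| ≤ 2 * ε * R := by
  lift R to ℝ≥0 using hR0
  have := quad_bound (eps_nonneg hq) hq R.2 (outreach_lipschitz hn hc hR)
    (fun x hx => outreach_abs_le hn hc hR (by simpa using hx))
  refine this.trans (le_of_eq ?_)
  change ε * ((R : ℝ) + R) = _
  ring

lemma key_discrete (hN : 2 ≤ N) (hq : IsAccurateQuadrature u w ε) {K : ℝ} (hK : 0 ≤ K)
    (b : Euc N) (hb : K ≤ ‖b‖) :
    3 / 4 * ‖b‖ / √N - K - 4 * ε * ‖b‖ ≤ 2 * ∑ i, w i * max ⟪b, u i⟫ (-K) := by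
  have h1 := key_lower hN b K
  have hl : LipschitzWith ‖b‖₊ (fun x : Euc N => max ⟪b, x⟫ (-K)) := by
    refine LipschitzWith.max_const ?_ _
    refine LipschitzWith.of_le_add_mul _ fun x y => ?_
    have h2 : ⟪b, x⟫ = ⟪b, y⟫ + ⟪b, x - y⟫ := by rw [inner_sub_right]; ring
    have h3 := real_inner_le_norm b (x - y)
    rw [dist_eq_norm, coe_nnnorm]
    linarith
  have h2 := quad_bound (eps_nonneg hq) hq (norm_nonneg b) hl (by
    intro x hx
    have hx' : ‖x‖ = 1 := by simpa using hx
    have h3 := abs_le.1 (abs_real_inner_le_norm b x)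
    rw [hx', mul_one] at h3
    exact abs_le.2 ⟨le_max_of_le_left h3.1, max_le h3.2 (by linarith)⟩)
  rw [coe_nnnorm] at h2
  have := (abs_le.1 h2).2
  linarith

end Quad

theorem VCP_VDP_error_bounds {N m : ℕ} (hN : 2 ≤ N)
    (u : Fin m → Euc N) (w : Fin m → ℝ) (ε : ℝ)
    (hq : IsAccurateQuadrature u w ε)
    (δ : ℝ) (hδ : δ = dispersion (Set.range u))
    (hε : ε ≤ 1 / (10 * Real.sqrt N)) (hδ' : δ ≤ 1 / (10 * Real.sqrt N))
    (C : Euc N → ℝ) (LC : ℝ≥0) (hC : LipschitzOnWith LC C (Metric.sphere (0 : Euc N) 1)) :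
    VCP C - VDP u w C ≤ 12 * Real.sqrt N * supNormSphere C * (2 * ε + δ) + (LC : ℝ) * δ ∧
      VDP u w C - VCP C ≤ 8 * Real.sqrt N * supNormSphere C * ε := by
  have hprob := sphereMeasure_prob hN
  have hε0 := eps_nonneg hq
  have hsw := abs_le.1 (sum_w hN hq)
  have hs1 : (1 : ℝ) ≤ √N := by
    rw [Real.one_le_sqrt]; exact_mod_cast (by omega : 1 ≤ N)
  have hs : (0 : ℝ) < √N := by linarith
  have hεs : √N * ε ≤ 1 / 10 := by
    rw [le_div_iff₀ (by positivity)] at hε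
    linarith
  have hδs : √N * δ ≤ 1 / 10 := by
    rw [le_div_iff₀ (by positivity)] at hδ'
    linarith
  have hε1 : ε ≤ 1 / 10 := by nlinarith
  have hδ0 : 0 ≤ δ := by
    rw [hδ]; exact Real.iSup_nonneg fun _ => Real.iInf_nonneg fun _ => norm_nonneg _
  have hm : Nonempty (Fin m) := by
    by_contra h
    rw [not_nonempty_iff] at h
    simp at hsw
    linarith
  have hnode : ∀ x ∈ sphere (0 : Euc N) 1, ∃ i, ‖x - u i‖ ≤ δ := by
    intro x hx
    obtain ⟨i, hi⟩ := Finite.exists_min (fun i => ‖x - u i‖)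
    refine ⟨i, ?_⟩
    have hn : Nonempty (range u) := ⟨⟨u i, i, rfl⟩⟩
    have h1 : ‖x - u i‖ ≤ ⨅ v : range u, ‖x - (v : Euc N)‖ := by
      refine le_ciInf ?_
      rintro ⟨_, j, rfl⟩
      exact hi j
    refine h1.trans ?_
    rw [hδ]
    refine le_ciSup (f := fun y : sphere (0 : Euc N) 1 => ⨅ v : range u, ‖(y : Euc N) - (v : Euc N)‖)
      ?_ (⟨x, hx⟩ : sphere (0 : Euc N) 1)
    refine ⟨2, ?_⟩
    rintro _ ⟨y, rfl⟩
    refine (ciInf_le ⟨0, ?_⟩ (⟨u i, i, rfl⟩ : range u)).trans ?_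
    · rintro _ ⟨v, rfl⟩
      exact norm_nonneg _
    · have h2 : ‖(y : Euc N)‖ = 1 := by simp
      have h3 : ‖u i‖ = 1 := by simpa using hq.1 i
      have := norm_sub_le (y : Euc N) (u i)
      simp only
      linarith
  set K := supNormSphere C with hKdef
  have hK : 0 ≤ K := supNorm_nonneg C
  have hCK : ∀ x ∈ sphere (0 : Euc N) 1, |C x| ≤ K := fun x hx => le_supNorm hC.continuousOn hx
  have hunit : ∀ x : sphere (0 : Euc N) 1, ‖(x : Euc N)‖ = 1 := fun x => by simp
  -- integrability of outreach functions
  have hint : ∀ B : Set (Euc N), B.Nonempty → IsCompact B →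
      Integrable (fun x : sphere (0 : Euc N) 1 => outreach B x) (sphereMeasure N) := by
    intro B hn hc
    obtain ⟨b, -, hb⟩ := exists_max_norm hn hc
    exact sphere_integrable hN _
      ((outreach_lipschitz (R := ‖b‖₊) hn hc hb).continuous.comp continuous_subtype_val)
  -- boundedness below of the two problems
  have hbddC : BddBelow (meanHalfWidth '' CInf C) := by
    refine ⟨-K, ?_⟩
    rintro _ ⟨B, ⟨hn, -, hc, hB⟩, rfl⟩
    have : ∫ x : sphere (0 : Euc N) 1, (-K) ∂(sphereMeasure N) ≤ meanHalfWidth B := by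
      refine integral_mono (integrable_const _) (hint B hn hc) fun x => ?_
      exact (neg_le_of_abs_le (hCK x x.2)).trans (hB x x.2)
    simpa using this
  have hbddD : BddBelow (quadSum u w '' DInf C (range u)) := by
    refine ⟨∑ i, w i * (-K), ?_⟩
    rintro _ ⟨B, ⟨hn, -, hc, hB⟩, rfl⟩
    refine Finset.sum_le_sum fun i _ => mul_le_mul_of_nonneg_left ?_ (hq.2.1 i)
    exact (neg_le_of_abs_le (hCK _ (hq.1 i))).trans (hB _ ⟨i, rfl⟩)
  -- the ball of radius K
  have hballC : closedBall (0 : Euc N) K ∈ CInf C := by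
    refine ⟨⟨0, by simpa using hK⟩, convex_closedBall _ _, isCompact_closedBall _ _, fun x hx => ?_⟩
    rw [outreach_ball hK (by simpa using hx)]
    exact (le_abs_self _).trans (hCK x hx)
  have hsub : CInf C ⊆ DInf C (range u) := by
    rintro B ⟨hn, hv, hc, hB⟩
    refine ⟨hn, hv, hc, ?_⟩
    rintro _ ⟨i, rfl⟩
    exact hB _ (hq.1 i)
  have hVC : VCP C ≤ K := by
    refine csInf_le hbddC ⟨_, hballC, ?_⟩
    simp [meanHalfWidth, outreach_ball hK (hunit _)]
  have hVD : VDP u w C ≤ K * (1 + ε) := by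
    have h1 : VDP u w C ≤ quadSum u w (closedBall (0 : Euc N) K) :=
      csInf_le hbddD ⟨_, hsub hballC, rfl⟩
    refine h1.trans ?_
    have h2 : quadSum u w (closedBall (0 : Euc N) K) = K * ∑ i, w i := by
      rw [quadSum, Finset.mul_sum]
      refine Finset.sum_congr rfl fun i _ => ?_
      rw [outreach_ball hK (by simpa using hq.1 i)]; ring
    rw [h2]
    gcongr
    linarith [hsw.1]
  constructor
  · refine le_of_forall_pos_le_add fun η hη => ?_
    obtain ⟨_, ⟨B, hB, rfl⟩, hlt⟩ := exists_lt_of_csInf_lt (⟨_, _, hsub hballC, rfl⟩ :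
      (quadSum u w '' DInf C (range u)).Nonempty)
      (show sInf (quadSum u w '' DInf C (range u)) < VDP u w C + η / 4 by
        change VDP u w C < _
        linarith)
    obtain ⟨hn, hv, hc, hfeas⟩ := hB
    obtain ⟨b, hb, hmax⟩ := exists_max_norm hn hc
    set R := ‖b‖ with hRdef
    have hR0 : 0 ≤ R := norm_nonneg b
    have hRle : R ≤ 12 * √N * K + 2 * √N * η := by
      by_cases hRK : R ≤ K
      · nlinarith [mul_nonneg (sub_nonneg.2 hs1) hK, mul_pos hs hη, mul_nonneg hs.le hK]
      push Not at hRK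
      have h1 := key_discrete hN hq hK b hRK.le
      have h2 : ∑ i, w i * max ⟪b, u i⟫ (-K) ≤ quadSum u w B := by
        refine Finset.sum_le_sum fun i _ => mul_le_mul_of_nonneg_left ?_ (hq.2.1 i)
        exact max_le (le_outreach_s8 hc _ hb)
          ((neg_le_of_abs_le (hCK _ (hq.1 i))).trans (hfeas _ ⟨i, rfl⟩))
      have h3 : 3 / 4 * R / √N - 4 * ε * R ≤ K + 2 * (K * (1 + ε) + η / 4) := by linarith
      have h4 : √N * (3 / 4 * R / √N - 4 * ε * R) = (3 / 4 - 4 * (√N * ε)) * R := by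
        field_simp
      have h5 := mul_le_mul_of_nonneg_left h3 hs.le
      rw [h4] at h5
      have h6 : (3 / 4 - 4 * (1 / 10)) * R ≤ (3 / 4 - 4 * (√N * ε)) * R := by gcongr
      have h7 : K + 2 * (K * (1 + ε) + η / 4) ≤ K + 2 * (K * (1 + 1 / 10) + η / 4) := by gcongr
      have h8 := mul_le_mul_of_nonneg_left h7 hs.le
      nlinarith [mul_pos hs hη, mul_nonneg hs.le hK]
    set r := (R + LC) * δ with hr
    have hr0 : 0 ≤ r := by positivity
    have hfeas' : image2 (· + ·) B (closedBall (0 : Euc N) r) ∈ CInf C := by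
      refine ⟨hn.image2 ⟨0, by simpa using hr0⟩, ?_,
        hc.add (isCompact_closedBall _ _), fun x hx => ?_⟩
      · exact hv.add (convex_closedBall _ _)
      · rw [outreach_add_ball hn hc hr0 (by simpa using hx)]
        obtain ⟨i, hi⟩ := hnode x hx
        have h1 := outreach_sub_le hn hc hmax (u i) x
        have h2 := hfeas (u i) ⟨i, rfl⟩
        have h3 := hC.dist_le_mul x hx (u i) (hq.1 i)
        rw [dist_eq_norm, dist_eq_norm, Real.norm_eq_abs] at h3
        have h4 := (abs_le.1 h3).2
        rw [norm_sub_rev] at h1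
        have h5 : (R + LC) * ‖x - u i‖ ≤ r := by rw [hr]; gcongr
        linarith
    have h1 : VCP C ≤ meanHalfWidth B + r := by
      refine csInf_le hbddC ⟨_, hfeas', ?_⟩
      unfold meanHalfWidth
      simp only [outreach_add_ball hn hc hr0 (hunit _)]
      rw [integral_add (hint B hn hc) (integrable_const _)]
      simp
    have h2 := (abs_le.1 (quad_outreach hq hn hc hR0 hmax)).2
    have h3 : R * (2 * ε + δ) ≤ (12 * √N * K + 2 * √N * η) * (2 * ε + δ) := by gcongr
    have h4 : 2 * √N * η * (2 * ε + δ) ≤ 3 * η / 4 := by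
      have : 2 * √N * η * (2 * ε + δ) = 2 * η * (2 * (√N * ε) + √N * δ) := by ring
      rw [this]
      nlinarith
    linarith
  · refine le_of_forall_pos_le_add fun η hη => ?_
    obtain ⟨_, ⟨B, hB, rfl⟩, hlt⟩ := exists_lt_of_csInf_lt (⟨_, _, hballC, rfl⟩ :
      (meanHalfWidth '' CInf C).Nonempty)
      (show sInf (meanHalfWidth '' CInf C) < VCP C + η / 4 by
        change VCP C < _
        linarith)
    obtain ⟨b, hb, hmax⟩ := exists_max_norm hB.1 hB.2.2.1
    have h0 : VDP u w C ≤ quadSum u w B := csInf_le hbddD ⟨_, hsub hB, rfl⟩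
    obtain ⟨hn, hv, hc, hfeas⟩ := hB
    set R := ‖b‖ with hRdef
    have hR0 : 0 ≤ R := norm_nonneg b
    have h1 := key_lower hN b K
    have h2 : ∫ s : sphere (0 : Euc N) 1, max ⟪b, (s : Euc N)⟫ (-K) ∂(sphereMeasure N)
        ≤ meanHalfWidth B := by
      refine integral_mono (sphere_integrable hN _ (by fun_prop)) (hint B hn hc) fun x => ?_
      exact max_le (le_outreach_s8 hc _ hb) ((neg_le_of_abs_le (hCK x x.2)).trans (hfeas x x.2))
    have h3 : 3 / 4 * R / √N ≤ 3 * K + η / 2 := by linarith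
    rw [div_le_iff₀ hs] at h3
    have h4 := (abs_le.1 (quad_outreach hq hn hc hR0 hmax)).1
    have h5 : R ≤ 4 * √N * K + √N * η := by nlinarith [mul_pos hs hη]
    have h6 : 2 * ε * R ≤ 2 * ε * (4 * √N * K + √N * η) := by gcongr
    have h7 : √N * ε * η ≤ 1 / 10 * η := by gcongr
    linarith
end
end

section
/- Let C : S^{N-1} → ℝ be Lipschitz. Then for every γ ≥ 0 the collection 𝒞^γ is nonempty and compact as a subset of the space of nonempty compact subsets of ℝ^N equipped with the Hausdorff distance d_H. In particular, the continuous problem has an optimal solution: there exists 𝓑 ∈ 𝒞^∞ with ∫_{S^{N-1}} B(𝓑,u) dσ(u) = V^CP. -/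
open MeasureTheory Metric Set TopologicalSpace Filter
open scoped RealInnerProductSpace NNReal ENNReal

noncomputable section

lemma aux_bdd {N : ℕ} {B : Set (Euc N)} (hB : IsCompact B) (u : Euc N) :
    BddAbove ((fun b => ⟪b, u⟫) '' B) :=
  (hB.image (by fun_prop)).bddAbove

lemma aux_le_outreach {N : ℕ} {B : Set (Euc N)} (hB : IsCompact B) {b : Euc N} (hb : b ∈ B)
    (u : Euc N) : ⟪b, u⟫ ≤ outreach B u :=
  le_csSup (aux_bdd hB u) ⟨b, hb, rfl⟩

lemma aux_outreach_le {N : ℕ} {B : Set (Euc N)} (hB : B.Nonempty) {u : Euc N} {t : ℝ}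
    (h : ∀ b ∈ B, ⟪b, u⟫ ≤ t) : outreach B u ≤ t := by
  apply csSup_le (hB.image _)
  rintro _ ⟨b, hb, rfl⟩
  exact h b hb

lemma aux_outreach_continuous {N : ℕ} {B : Set (Euc N)} (hB : IsCompact B) (hn : B.Nonempty) :
    Continuous (fun u : Euc N => outreach B u) := by
  obtain ⟨R, hR⟩ := hB.isBounded.exists_norm_le
  have hR0 : 0 ≤ R := by
    obtain ⟨b, hb⟩ := hn
    exact (norm_nonneg b).trans (hR b hb)
  refine (LipschitzWith.of_le_add_mul ⟨R, hR0⟩ ?_).continuous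
  intro u v
  apply aux_outreach_le hn
  intro b hb
  have h1 := aux_le_outreach hB hb v
  have h2 : ⟪b, u⟫ = ⟪b, v⟫ + ⟪b, u - v⟫ := by rw [inner_sub_right]; ring
  have h3 : ⟪b, u - v⟫ ≤ ‖b‖ * ‖u - v‖ := real_inner_le_norm _ _
  have h4 : ‖b‖ * ‖u - v‖ ≤ R * ‖u - v‖ := by gcongr; exact hR b hb
  rw [dist_eq_norm]
  change _ ≤ _ + R * _
  linarith

lemma aux_finite (N : ℕ) : IsFiniteMeasure (sphereMeasure N) := by
  unfold sphereMeasure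
  by_cases h : ((volume : Measure (Euc N)).toSphere) Set.univ = 0
  · rw [Measure.measure_univ_eq_zero] at h
    rw [h]
    simp only [smul_zero]
    infer_instance
  · exact Measure.smul_finite _ (ENNReal.inv_ne_top.2 h)

lemma aux_openPos (N : ℕ) : (sphereMeasure N).IsOpenPosMeasure := by
  constructor
  intro U hU hne
  unfold sphereMeasure
  rw [Measure.smul_apply, smul_eq_mul]
  exact mul_ne_zero (ENNReal.inv_ne_zero.2 (measure_ne_top _ _)) (hU.measure_ne_zero _ hne)

lemma aux_integrable {N : ℕ} {f : Metric.sphere (0 : Euc N) 1 → ℝ} (hf : Continuous f) :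
    Integrable f (sphereMeasure N) := by
  have := aux_finite N
  exact hf.integrable_of_hasCompactSupport (HasCompactSupport.of_compactSpace f)

lemma aux_pos {N : ℕ} : ∃ c : ℝ, 0 < c ∧ ∀ b : Euc N,
    c * ‖b‖ ≤ ∫ u : Metric.sphere (0 : Euc N) 1, max ⟪b, (u : Euc N)⟫ 0 ∂(sphereMeasure N) := by
  have := aux_finite N
  have := aux_openPos N
  set F : Euc N → ℝ := fun b =>
    ∫ u : Metric.sphere (0 : Euc N) 1, max ⟪b, (u : Euc N)⟫ 0 ∂(sphereMeasure N) with hF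
  have hcont : Continuous F := by
    have h := continuous_parametric_integral_of_continuous (μ := sphereMeasure N)
      (f := fun (b : Euc N) (u : Metric.sphere (0 : Euc N) 1) => max ⟪b, (u : Euc N)⟫ 0)
      (s := Set.univ) (by fun_prop) isCompact_univ
    simpa only [setIntegral_univ] using h
  have hposF : ∀ b : Euc N, ‖b‖ = 1 → 0 < F b := by
    intro b hb
    have hc : Continuous fun u : Metric.sphere (0 : Euc N) 1 => max ⟪b, (u : Euc N)⟫ 0 := by
      fun_prop
    apply hc.integral_pos_of_hasCompactSupport_nonneg_nonzero
      (HasCompactSupport.of_compactSpace _) (fun _ => le_max_right _ _) (x := ⟨b, by simpa using hb⟩)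
    simp [real_inner_self_eq_norm_sq, hb]
  have hscale : ∀ (b : Euc N), b ≠ 0 → F b = ‖b‖ * F (‖b‖⁻¹ • b) := by
    intro b hb
    have hb' : ‖b‖ ≠ 0 := norm_ne_zero_iff.2 hb
    simp only [hF]
    rw [← integral_const_mul]
    congr 1
    ext u
    rw [mul_max_of_nonneg _ _ (norm_nonneg b), inner_smul_left]
    simp [hb']
  by_cases hne : (Metric.sphere (0 : Euc N) 1).Nonempty
  · obtain ⟨x, hx, hmin⟩ := (isCompact_sphere (0 : Euc N) 1).exists_isMinOn hne hcont.continuousOn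
    refine ⟨F x, hposF x (by simpa using hx), fun b => ?_⟩
    by_cases hb : b = 0
    · subst hb; simp
    · change _ ≤ F b
      rw [hscale b hb, mul_comm]
      gcongr
      apply hmin
      simp [norm_smul, hb]
  · refine ⟨1, one_pos, fun b => ?_⟩
    have hb : b = 0 := by
      by_contra hb
      exact hne ⟨‖b‖⁻¹ • b, by simp [norm_smul, hb]⟩
    subst hb; simp

lemma aux_outreach_dist {N : ℕ} (K L : NonemptyCompacts (Euc N)) (u : Euc N) (hu : ‖u‖ = 1) :
    outreach (K : Set (Euc N)) u ≤ outreach (L : Set (Euc N)) u + dist K L := by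
  apply aux_outreach_le K.nonempty
  intro b hb
  refine le_of_forall_pos_le_add fun ε hε => ?_
  obtain ⟨y, hy, hxy⟩ := exists_dist_lt_of_hausdorffDist_lt (r := dist K L + ε) hb
    (by rw [NonemptyCompacts.dist_eq]; linarith)
    (hausdorffEDist_ne_top_of_nonempty_of_bounded K.nonempty L.nonempty
      K.isCompact.isBounded L.isCompact.isBounded)
  have h1 := aux_le_outreach L.isCompact hy u
  have h2 : ⟪b, u⟫ = ⟪y, u⟫ + ⟪b - y, u⟫ := by rw [inner_sub_left]; ring
  have h3 : ⟪b - y, u⟫ ≤ ‖b - y‖ * ‖u‖ := real_inner_le_norm _ _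
  rw [hu, mul_one, ← dist_eq_norm] at h3
  linarith

lemma aux_outreach_cont_left {N : ℕ} (u : Euc N) (hu : ‖u‖ = 1) :
    Continuous fun K : NonemptyCompacts (Euc N) => outreach (K : Set (Euc N)) u :=
  (LipschitzWith.of_le_add fun K L => aux_outreach_dist K L u hu).continuous

lemma aux_int_outreach {N : ℕ} {B : Set (Euc N)} (hB : IsCompact B) (hn : B.Nonempty) :
    Integrable (fun u : Metric.sphere (0 : Euc N) 1 => outreach B (u : Euc N))
      (sphereMeasure N) :=
  aux_integrable ((aux_outreach_continuous hB hn).comp continuous_subtype_val)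

lemma aux_mhw_continuous {N : ℕ} :
    Continuous fun K : NonemptyCompacts (Euc N) => meanHalfWidth (K : Set (Euc N)) := by
  have := aux_finite N
  refine (LipschitzWith.of_le_add_mul
    ⟨(sphereMeasure N).real Set.univ, measureReal_nonneg⟩ ?_).continuous
  intro K L
  have hL := aux_int_outreach L.isCompact L.nonempty
  have h : meanHalfWidth (K : Set (Euc N)) ≤
      ∫ u : Metric.sphere (0 : Euc N) 1, (outreach (L : Set (Euc N)) (u : Euc N) + dist K L)
        ∂(sphereMeasure N) := by
    apply integral_mono (aux_int_outreach K.isCompact K.nonempty) (hL.add (integrable_const _))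
    intro u
    exact aux_outreach_dist K L u (by simpa using u.2)
  rw [integral_add hL (integrable_const _), integral_const, smul_eq_mul] at h
  exact h

lemma aux_convex_closed {N : ℕ} :
    IsClosed {K : NonemptyCompacts (Euc N) | Convex ℝ (K : Set (Euc N))} := by
  rw [← isSeqClosed_iff_isClosed]
  intro f K hf hK
  have hd : Tendsto (fun n => dist (f n) K) atTop (nhds 0) := tendsto_iff_dist_tendsto_zero.1 hK
  intro x hx y hy a b ha hb hab
  rw [← K.isCompact.isClosed.closure_eq, Metric.mem_closure_iff]
  intro ε hε
  obtain ⟨n, hn⟩ := (hd.eventually (gt_mem_nhds (half_pos hε))).exists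
  have fin : hausdorffEDist (f n : Set (Euc N)) (K : Set (Euc N)) ≠ ⊤ :=
    hausdorffEDist_ne_top_of_nonempty_of_bounded (f n).nonempty K.nonempty
      (f n).isCompact.isBounded K.isCompact.isBounded
  rw [NonemptyCompacts.dist_eq] at hn
  obtain ⟨x', hx', hxx⟩ := exists_dist_lt_of_hausdorffDist_lt' hx hn fin
  obtain ⟨y', hy', hyy⟩ := exists_dist_lt_of_hausdorffDist_lt' hy hn fin
  obtain ⟨z, hz, hzz⟩ := exists_dist_lt_of_hausdorffDist_lt (hf n hx' hy' ha hb hab) hn fin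
  refine ⟨z, hz, ?_⟩
  have h1 : dist (a • x + b • y) (a • x' + b • y') ≤ ε / 2 := by
    rw [dist_comm] at hxx hyy
    calc _ ≤ dist (a • x) (a • x') + dist (b • y) (b • y') := dist_add_add_le _ _ _ _
      _ = a * dist x x' + b * dist y y' := by
        rw [dist_smul₀, dist_smul₀, Real.norm_of_nonneg ha, Real.norm_of_nonneg hb]
      _ ≤ a * (ε / 2) + b * (ε / 2) := by
        rw [dist_comm x, dist_comm y] at *
        gcongr
      _ = ε / 2 := by rw [← add_mul, hab, one_mul]
  linarith [dist_triangle (a • x + b • y) (a • x' + b • y') z]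

lemma aux_feasible_closed {N : ℕ} (C : Euc N → ℝ) :
    IsClosed {K : NonemptyCompacts (Euc N) | (K : Set (Euc N)) ∈ CInf C} := by
  have h : {K : NonemptyCompacts (Euc N) | (K : Set (Euc N)) ∈ CInf C} =
      {K : NonemptyCompacts (Euc N) | Convex ℝ (K : Set (Euc N))} ∩
      ⋂ u ∈ Metric.sphere (0 : Euc N) 1,
        {K : NonemptyCompacts (Euc N) | C u ≤ outreach (K : Set (Euc N)) u} := by
    ext K
    simp only [CInf, mem_ofPred_eq, mem_inter_iff, mem_iInter]
    exact ⟨fun h => ⟨h.2.1, h.2.2.2⟩, fun h => ⟨K.nonempty, h.1, K.isCompact, h.2⟩⟩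
  rw [h]
  refine aux_convex_closed.inter (isClosed_biInter fun u hu => ?_)
  exact isClosed_le continuous_const (aux_outreach_cont_left u (by simpa using hu))

lemma aux_C_bound {N : ℕ} {C : Euc N → ℝ} {LC : ℝ≥0}
    (hC : LipschitzOnWith LC C (Metric.sphere (0 : Euc N) 1)) :
    ∃ M : ℝ, 0 ≤ M ∧ ∀ u ∈ Metric.sphere (0 : Euc N) 1, |C u| ≤ M := by
  obtain ⟨M, hM⟩ := (isCompact_sphere (0 : Euc N) 1).exists_bound_of_continuousOn hC.continuousOn
  exact ⟨max M 0, le_max_right _ _, fun u hu => (hM u hu).trans (le_max_left _ _)⟩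

lemma aux_sublevel_compact {N : ℕ} {C : Euc N → ℝ} {LC : ℝ≥0}
    (hC : LipschitzOnWith LC C (Metric.sphere (0 : Euc N) 1)) (t : ℝ) :
    IsCompact {K : NonemptyCompacts (Euc N) |
      (K : Set (Euc N)) ∈ CInf C ∧ meanHalfWidth (K : Set (Euc N)) ≤ t} := by
  have := aux_finite N
  obtain ⟨M, hM0, hM⟩ := aux_C_bound hC
  obtain ⟨c, hc, hcb⟩ := aux_pos (N := N)
  set m := (sphereMeasure N).real Set.univ
  have hcl : IsClosed {K : NonemptyCompacts (Euc N) |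
      (K : Set (Euc N)) ∈ CInf C ∧ meanHalfWidth (K : Set (Euc N)) ≤ t} :=
    (aux_feasible_closed C).inter (isClosed_le aux_mhw_continuous continuous_const)
  refine (NonemptyCompacts.isCompact_subsets_of_isCompact
    (isCompact_closedBall (0 : Euc N) ((t + m * M) / c))).of_isClosed_subset hcl ?_
  rintro K ⟨hK, hKt⟩ b hb
  rw [mem_closedBall_zero_iff, le_div_iff₀ hc, mul_comm]
  refine (hcb b).trans ?_
  have hI := aux_int_outreach K.isCompact K.nonempty
  have h : ∫ u : Metric.sphere (0 : Euc N) 1, max ⟪b, (u : Euc N)⟫ 0 ∂(sphereMeasure N) ≤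
      ∫ u : Metric.sphere (0 : Euc N) 1, (outreach (K : Set (Euc N)) (u : Euc N) + M)
        ∂(sphereMeasure N) := by
    apply integral_mono (aux_integrable (by fun_prop)) (hI.add (integrable_const _))
    intro u
    have h1 := aux_le_outreach K.isCompact hb (u : Euc N)
    have h2 := hK.2.2.2 u u.2
    have h3 := (abs_le.1 (hM u u.2)).1
    change _ ≤ outreach (K : Set (Euc N)) (u : Euc N) + M
    exact max_le (by linarith) (by linarith)
  rw [integral_add hI (integrable_const _), integral_const, smul_eq_mul] at h
  change _ ≤ meanHalfWidth (K : Set (Euc N)) + m * M at h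
  linarith

lemma aux_feasible {N : ℕ} {C : Euc N → ℝ} {LC : ℝ≥0}
    (hC : LipschitzOnWith LC C (Metric.sphere (0 : Euc N) 1)) : (CInf C).Nonempty := by
  obtain ⟨M, hM0, hM⟩ := aux_C_bound hC
  refine ⟨closedBall 0 M, ⟨0, by simpa using hM0⟩, convex_closedBall _ _,
    isCompact_closedBall _ _, fun u hu => ?_⟩
  have hu1 : ‖u‖ = 1 := by simpa using hu
  have h := aux_le_outreach (isCompact_closedBall (0 : Euc N) M) (b := M • u)
    (by simp [norm_smul, hu1, abs_of_nonneg hM0]) u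
  rw [inner_smul_left, real_inner_self_eq_norm_sq, hu1] at h
  simp at h
  exact ((le_abs_self _).trans (hM u hu)).trans h

/-- for Lipschitz `C`, each `𝒞^γ` (γ ≥ 0) is nonempty and compact in the
space of nonempty compact subsets of `ℝ^N` with the Hausdorff distance; in particular
the continuous problem has an optimal solution. -/
theorem CGamma_nonempty_compact_and_exists_optimal {N : ℕ}
    (C : Euc N → ℝ) (LC : ℝ≥0) (hC : LipschitzOnWith LC C (Metric.sphere (0 : Euc N) 1)) :
    (∀ γ : ℝ, 0 ≤ γ →
        (CGamma C γ).Nonempty ∧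
          IsCompact {K : NonemptyCompacts (Euc N) | (K : Set (Euc N)) ∈ CGamma C γ}) ∧
      ∃ B ∈ CInf C, meanHalfWidth B = VCP C := by
  have hopt : ∃ B ∈ CInf C, meanHalfWidth B = VCP C := by
    obtain ⟨B₀, hB₀⟩ := aux_feasible hC
    obtain ⟨K, hK, hmin⟩ := (aux_sublevel_compact hC (meanHalfWidth B₀)).exists_isMinOn
      ⟨⟨⟨B₀, hB₀.2.2.1⟩, hB₀.1⟩, hB₀, le_rfl⟩ aux_mhw_continuous.continuousOn
    refine ⟨K, hK.1, ?_⟩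
    have hl : IsLeast (meanHalfWidth '' CInf C) (meanHalfWidth (K : Set (Euc N))) := by
      refine ⟨⟨K, hK.1, rfl⟩, ?_⟩
      rintro _ ⟨B, hB, rfl⟩
      rcases le_total (meanHalfWidth B) (meanHalfWidth B₀) with h | h
      · exact isMinOn_iff.1 hmin ⟨⟨B, hB.2.2.1⟩, hB.1⟩ ⟨hB, h⟩
      · exact hK.2.trans h
    exact hl.csInf_eq.symm
  refine ⟨fun γ hγ => ⟨?_, ?_⟩, hopt⟩
  · obtain ⟨B, hB, hBV⟩ := hopt
    exact ⟨B, hB, by rw [hBV]; simpa using hγ⟩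
  · have h := aux_sublevel_compact hC (γ + VCP C)
    simpa only [CGamma, mem_ofPred_eq, sub_le_iff_le_add] using h
end
end
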